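/- Let λ, μ, α ⊆ (k^l) with μ ⊆ λ, and suppose μ_1 ≠ β_1 where α/β is another skew shape in the rectangle satisfying α_2 − β_1 = λ_2 − μ_1, a_1 = l_1, m ≤ l_2 and b ≤ a_2 (in the notation λ = (λ_1^{l_1}, λ_2^{l_2}, λ_3^{l_3}), μ = (μ_1^m), α = (α_1^{a_1}, α_2^{a_2}, α_3^{a_3}), β = (β_1^b), all with three distinct part sizes). Then s_{λ/μ} ≠ s_{α/β}: there exists a partition ν with c(λ; μ, ν) ≠ c(α; β, ν). -/

import Mathlib

open YoungDiagram
open scoped Classical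

namespace LRSkew

/-- The cells of the skew diagram `lam/mu`. -/
def skewCells (lam mu : YoungDiagram) : Finset (ℕ × ℕ) := lam.cells \ mu.cells

/-- A semistandard filling of the skew shape `lam/mu`: entries are positive exactly on the
cells of the shape, rows are weakly increasing and columns are strictly increasing. -/
def IsSSYT (lam mu : YoungDiagram) (T : ℕ × ℕ → ℕ) : Prop :=
  (∀ p, p ∈ skewCells lam mu ↔ T p ≠ 0) ∧
  (∀ i j1 j2, (i, j1) ∈ skewCells lam mu → (i, j2) ∈ skewCells lam mu → j1 ≤ j2 →
    T (i, j1) ≤ T (i, j2)) ∧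
  (∀ i1 i2 j, (i1, j) ∈ skewCells lam mu → (i2, j) ∈ skewCells lam mu → i1 < i2 →
    T (i1, j) < T (i2, j))

/-- The number of entries equal to `k` among the cells read (in the reverse reading word:
right to left along rows, top row first) up to position `(i,j)`. -/
def prefixCount (lam mu : YoungDiagram) (T : ℕ × ℕ → ℕ) (i j k : ℕ) : ℕ :=
  ((skewCells lam mu).filter fun p => (p.1 < i ∨ (p.1 = i ∧ j ≤ p.2)) ∧ T p = k).card

/-- The reverse reading word of the filling is a lattice word. -/
def IsLattice (lam mu : YoungDiagram) (T : ℕ × ℕ → ℕ) : Prop :=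
  ∀ i j k, prefixCount lam mu T i j (k + 2) ≤ prefixCount lam mu T i j (k + 1)

/-- The number of entries of the filling equal to `k`. -/
def content (lam mu : YoungDiagram) (T : ℕ × ℕ → ℕ) (k : ℕ) : ℕ :=
  ((skewCells lam mu).filter fun p => T p = k).card

/-- A Littlewood–Richardson tableau of shape `lam/mu` and content `nu`. -/
def IsLR (lam mu nu : YoungDiagram) (T : ℕ × ℕ → ℕ) : Prop :=
  IsSSYT lam mu T ∧ IsLattice lam mu T ∧ ∀ i, content lam mu T (i + 1) = nu.rowLen i

/-- The Littlewood–Richardson coefficient `c(lam; mu, nu)`. -/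
noncomputable def lrCoeff (lam mu nu : YoungDiagram) : ℕ :=
  if mu ≤ lam then {T : ℕ × ℕ → ℕ | IsLR lam mu nu T}.ncard else 0

/-- Equality of the skew Schur functions `s_{lam/mu} = s_{alp/bet}`, expressed through
their expansions into Schur functions. -/
def SchurEq (lam mu alp bet : YoungDiagram) : Prop :=
  ∀ nu : YoungDiagram, lrCoeff lam mu nu = lrCoeff alp bet nu

/-- The rectangular Young diagram `(k^l)` with `l` rows of length `k`. -/
def rect (k l : ℕ) : YoungDiagram :=
  ⟨Finset.range l ×ˢ Finset.range k, by
    intro a b hba ha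
    simp only [Finset.coe_product, Set.mem_prod, Finset.mem_coe, Finset.mem_range] at ha ⊢
    exact ⟨lt_of_le_of_lt hba.1 ha.1, lt_of_le_of_lt hba.2 ha.2⟩⟩

/-- The complement of `nu` in the rectangle `(k^l)`, rotated by 180 degrees so that it is
again a partition: its parts are `(k - nu_l, …, k - nu_1)`. -/
def complRect (k l : ℕ) (nu : YoungDiagram) : YoungDiagram :=
  ⟨(rect k l).cells.filter fun p => (l - 1 - p.1, k - 1 - p.2) ∉ nu, by
    intro a b hba ha
    simp only [Finset.coe_filter, Set.mem_setOf_eq, mem_cells] at ha ⊢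
    refine ⟨(rect k l).isLowerSet hba ha.1, fun hmem => ha.2 ?_⟩
    exact nu.isLowerSet
      (Prod.mk_le_mk.mpr ⟨Nat.sub_le_sub_left hba.1 _, Nat.sub_le_sub_left hba.2 _⟩) hmem⟩

/-- The staircase partition `(n, n-1, …, 2, 1)`. -/
def staircase (n : ℕ) : YoungDiagram :=
  ⟨(Finset.range n ×ˢ Finset.range n).filter fun p => p.1 + p.2 < n, by
    intro a b hba ha
    simp only [Finset.coe_filter, Set.mem_setOf_eq, Finset.mem_product, Finset.mem_range] at ha ⊢
    exact ⟨⟨lt_of_le_of_lt hba.1 ha.1.1, lt_of_le_of_lt hba.2 ha.1.2⟩,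
      lt_of_le_of_lt (Nat.add_le_add hba.1 hba.2) ha.2⟩⟩

/-- A basic skew diagram: no empty rows and no empty columns. -/
def IsBasic (lam mu : YoungDiagram) : Prop :=
  (∀ i, i < lam.colLen 0 → mu.rowLen i < lam.rowLen i) ∧
  (∀ j, j < lam.rowLen 0 → mu.colLen j < lam.colLen j)

/-- A (basic) skew diagram is connected iff consecutive rows share a column. -/
def IsConnectedSkew (lam mu : YoungDiagram) : Prop :=
  ∀ i, i + 1 < lam.colLen 0 → mu.rowLen i < lam.rowLen (i + 1)

/-- The number of distinct (positive) part sizes of a partition. -/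
def dp (lam : YoungDiagram) : ℕ :=
  ((Finset.range (lam.colLen 0)).image fun i => lam.rowLen i).card

/-- A partition is a rectangle: all its parts are equal. -/
def IsRect (mu : YoungDiagram) : Prop :=
  ∀ i, i < mu.colLen 0 → mu.rowLen i = mu.rowLen 0

/-- Cells of a skew diagram in the same connected component: the reflexive–transitive
closure of sharing a row or a column. -/
def SameComp (s : Finset (ℕ × ℕ)) : ℕ × ℕ → ℕ × ℕ → Prop :=
  Relation.ReflTransGen fun a b => a ∈ s ∧ b ∈ s ∧ (a.1 = b.1 ∨ a.2 = b.2)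

/-- Two finite sets of boxes agree up to translation or 180°-rotation of each connected
component independently. -/
def UpToTransRot (s t : Finset (ℕ × ℕ)) : Prop :=
  ∃ f : ℕ × ℕ → ℕ × ℕ, Set.BijOn f ↑s ↑t ∧
    ∀ p ∈ s, ∀ q ∈ s, SameComp s p q →
      (((f q).1 : ℤ) - (f p).1 = (q.1 : ℤ) - p.1 ∧ ((f q).2 : ℤ) - (f p).2 = (q.2 : ℤ) - p.2) ∨
      (((f q).1 : ℤ) - (f p).1 = (p.1 : ℤ) - q.1 ∧ ((f q).2 : ℤ) - (f p).2 = (p.2 : ℤ) - q.2)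


/-! ### Helper material -/

/-- Numerical description of a skew shape `lam/mu` of the kind considered here. -/
structure Geo (lam mu : YoungDiagram) (l1 l2 l3 m L1 L2 L3 x : ℕ) : Prop where
  hl1 : 0 < l1
  hl2 : 0 < l2
  hl3 : 0 < l3
  hm : 0 < m
  hx : 0 < x
  h12 : L2 < L1
  h23 : L3 < L2
  h3 : 0 < L3
  hml : m ≤ l2
  hsub : x ≤ L2 ∨ (m ≤ l1 ∧ x ≤ L1)
  hle : mu ≤ lam
  mem : ∀ i j, (i, j) ∈ skewCells lam mu ↔
    ((i < l1 ∧ j < L1) ∨ (i < l1 + l2 ∧ j < L2) ∨ (i < l1 + l2 + l3 ∧ j < L3)) ∧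
      ¬ (i < m ∧ j < x)

theorem geo_of (lam mu : YoungDiagram) (l1 l2 l3 m L1 L2 L3 x : ℕ)
    (hl1 : 0 < l1) (hl2 : 0 < l2) (hl3 : 0 < l3) (hm : 0 < m) (hx : 0 < x)
    (h12 : L2 < L1) (h23 : L3 < L2) (h3 : 0 < L3)
    (hlam : ∀ i, lam.rowLen i =
      if i < l1 then L1 else if i < l1 + l2 then L2
        else if i < l1 + l2 + l3 then L3 else 0)
    (hmu : ∀ i, mu.rowLen i = if i < m then x else 0)
    (hle : mu ≤ lam) (hml : m ≤ l2) : Geo lam mu l1 l2 l3 m L1 L2 L3 x := by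
  refine ⟨hl1, hl2, hl3, hm, hx, h12, h23, h3, hml, ?_, hle, ?_⟩
  · have h : (m - 1, x - 1) ∈ lam := by
      apply hle
      rw [YoungDiagram.mem_iff_lt_rowLen, hmu]
      split_ifs <;> omega
    rw [YoungDiagram.mem_iff_lt_rowLen, hlam] at h
    split_ifs at h <;> omega
  · intro i j
    unfold skewCells
    rw [Finset.mem_sdiff, YoungDiagram.mem_cells, YoungDiagram.mem_cells,
      YoungDiagram.mem_iff_lt_rowLen, YoungDiagram.mem_iff_lt_rowLen, hlam, hmu]
    split_ifs <;> omega

theorem lr_finite (lam mu nu : YoungDiagram) : {T : ℕ × ℕ → ℕ | IsLR lam mu nu T}.Finite := by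
  let B := nu.colLen 0
  let ext : ({p // p ∈ skewCells lam mu} → Fin (B + 1)) → (ℕ × ℕ → ℕ) :=
    fun f p => if h : p ∈ skewCells lam mu then (f ⟨p, h⟩ : ℕ) else 0
  apply (Set.finite_range ext).subset
  rintro T ⟨⟨h0, -, -⟩, -, hc⟩
  have hb : ∀ p ∈ skewCells lam mu, T p < B + 1 := by
    intro p hp
    obtain ⟨v, hv⟩ := Nat.exists_eq_succ_of_ne_zero ((h0 p).1 hp)
    have h1 : 0 < content lam mu T (v + 1) := by
      apply Finset.card_pos.2
      exact ⟨p, Finset.mem_filter.2 ⟨hp, hv⟩⟩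
    rw [hc, ← YoungDiagram.mem_iff_lt_rowLen, YoungDiagram.mem_iff_lt_colLen] at h1
    simp only [B]
    omega
  refine ⟨fun p => ⟨T p.1, hb p.1 p.2⟩, ?_⟩
  funext p
  by_cases hp : p ∈ skewCells lam mu
  · simp [ext, hp]
  · have : T p = 0 := by
      by_contra h
      exact hp ((h0 p).2 h)
    simp [ext, hp, this]

theorem lr_ne_zero_iff {lam mu : YoungDiagram} (nu : YoungDiagram) (hle : mu ≤ lam) :
    lrCoeff lam mu nu ≠ 0 ↔ ∃ T, IsLR lam mu nu T := by
  unfold lrCoeff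
  rw [if_pos hle, ← Nat.pos_iff_ne_zero, Set.ncard_pos (lr_finite lam mu nu)]
  rfl

theorem lattice_content {lam mu : YoungDiagram} {T : ℕ × ℕ → ℕ} (hL : IsLattice lam mu T) (k : ℕ) :
    content lam mu T (k + 2) ≤ content lam mu T (k + 1) := by
  obtain ⟨N, hN⟩ : ∃ N, ∀ p ∈ skewCells lam mu, p.1 < N :=
    ⟨(skewCells lam mu).sup (fun p => p.1) + 1, fun p hp =>
      Nat.lt_succ_of_le (Finset.le_sup (f := fun p : ℕ × ℕ => p.1) hp)⟩
  have key : ∀ v, prefixCount lam mu T N 0 v = content lam mu T v := by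
    intro v
    unfold prefixCount content
    congr 1
    apply Finset.filter_congr
    intro p hp
    simp [hN p hp]
  have := hL N 0 k
  rwa [key, key] at this

theorem exists_nu {lam mu : YoungDiagram} {T : ℕ × ℕ → ℕ} (hS : IsSSYT lam mu T)
    (hL : IsLattice lam mu T) : ∃ nu, IsLR lam mu nu T := by
  have hanti : Antitone fun i => content lam mu T (i + 1) :=
    antitone_nat_of_succ_le fun n => lattice_content hL n
  obtain ⟨B, hB⟩ : ∃ B, ∀ p ∈ skewCells lam mu, T p < B :=
    ⟨(skewCells lam mu).sup T + 1, fun p hp => Nat.lt_succ_of_le (Finset.le_sup (f := T) hp)⟩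
  have hcB : ∀ i j, j < content lam mu T (i + 1) → i < B ∧ j < (skewCells lam mu).card := by
    intro i j h
    constructor
    · have : 0 < content lam mu T (i + 1) := by omega
      obtain ⟨p, hp⟩ := Finset.card_pos.1 this
      rw [Finset.mem_filter] at hp
      have := hB p hp.1
      omega
    · exact lt_of_lt_of_le h (Finset.card_filter_le _ _)
  let nu : YoungDiagram :=
    ⟨(Finset.range B ×ˢ Finset.range (skewCells lam mu).card).filter
      fun p => p.2 < content lam mu T (p.1 + 1), by
      intro a b hba ha
      simp only [Finset.coe_filter, Set.mem_ofPred_eq, Finset.mem_product, Finset.mem_range] at ha ⊢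
      have h1 := hanti hba.1
      have h2 : b.2 ≤ a.2 := hba.2
      simp only at h1
      have h3 : b.2 < content lam mu T (b.1 + 1) := by omega
      exact ⟨hcB _ _ h3, h3⟩⟩
  have hmem : ∀ i j, (i, j) ∈ nu ↔ j < content lam mu T (i + 1) := by
    intro i j
    rw [← YoungDiagram.mem_cells]
    simp only [nu, Finset.mem_filter, Finset.mem_product, Finset.mem_range]
    exact ⟨fun h => h.2, fun h => ⟨hcB _ _ h, h⟩⟩
  refine ⟨nu, hS, hL, fun i => ?_⟩
  have h : ∀ j, j < nu.rowLen i ↔ j < content lam mu T (i + 1) := by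
    intro j
    rw [← YoungDiagram.mem_iff_lt_rowLen, hmem]
  have h1 := h (nu.rowLen i)
  have h2 := h (content lam mu T (i + 1))
  omega

/-- Entries in row `i` of an LR filling are at most `i + 1`. -/
theorem entry_le {lam mu : YoungDiagram} {T : ℕ × ℕ → ℕ} (hS : IsSSYT lam mu T)
    (hL : IsLattice lam mu T) : ∀ i j, (i, j) ∈ skewCells lam mu → T (i, j) ≤ i + 1 := by
  intro i
  induction i using Nat.strong_induction_on with
  | _ i ih =>
    intro j hj
    by_contra! hlt
    obtain ⟨v, hv⟩ : ∃ v, T (i, j) = v + 2 := ⟨T (i, j) - 2, by omega⟩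
    have h1 : 0 < prefixCount lam mu T i j (v + 2) := by
      apply Finset.card_pos.2
      exact ⟨(i, j), Finset.mem_filter.2 ⟨hj, by simp [hv]⟩⟩
    have h2 := lt_of_lt_of_le h1 (hL i j v)
    obtain ⟨⟨i', j'⟩, hp⟩ := Finset.card_pos.1 h2
    rw [Finset.mem_filter] at hp
    obtain ⟨hp, hpos, hT⟩ := hp
    rcases hpos with h | ⟨h, h'⟩
    · have := ih i' h j' hp
      simp only at h
      omega
    · simp only at h h'
      subst h
      have := hS.2.1 i' j j' hj hp h'
      omega

/-- Cells in row `i` with entry satisfying a condition. -/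
theorem row_lemma {lam mu : YoungDiagram} {T : ℕ × ℕ → ℕ} (hS : IsSSYT lam mu T)
    (hL : IsLattice lam mu T) (i k : ℕ) :
    ((skewCells lam mu).filter fun p => p.1 = i ∧ k + 1 ≤ T p).card ≤
      content lam mu T (k + 1) := by
  set S := skewCells lam mu with hSdef
  let c : ℕ → ℕ := fun v => (S.filter fun p => p.1 < i ∧ T p = v).card
  let n : ℕ → ℕ := fun v => (S.filter fun p => p.1 = i ∧ T p = v).card
  let g : ℕ → ℕ := fun v => (S.filter fun p => p.1 = i ∧ v ≤ T p).card
  have hg : ∀ v, g v = n v + g (v + 1) := by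
    intro v
    simp only [g, n]
    rw [← Finset.card_union_of_disjoint]
    · congr 1
      ext p
      simp only [Finset.mem_filter, Finset.mem_union]
      constructor
      · rintro ⟨a, b, d⟩
        rcases Nat.eq_or_lt_of_le d with e | e
        · left; exact ⟨a, b, e.symm⟩
        · right; exact ⟨a, b, e⟩
      · rintro (⟨a, b, d⟩ | ⟨a, b, d⟩)
        · exact ⟨a, b, by omega⟩
        · exact ⟨a, b, by omega⟩
    · rw [Finset.disjoint_left]
      intro p h1 h2
      rw [Finset.mem_filter] at h1 h2
      omega
  have hstep : ∀ v, c (v + 2) + n (v + 2) ≤ c (v + 1) := by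
    intro v
    obtain ⟨J, hJ1, hJ2⟩ : ∃ J, (∀ j, (i, j) ∈ S → T (i, j) = v + 2 → J ≤ j) ∧
        (∀ j, (i, j) ∈ S → T (i, j) = v + 1 → ¬ J ≤ j) := by
      by_cases hex : ∃ j, (i, j) ∈ S ∧ T (i, j) = v + 2
      · refine ⟨Nat.find hex, fun j h1 h2 => Nat.find_min' hex ⟨h1, h2⟩, ?_⟩
        intro j h1 h2 h3
        have hs := Nat.find_spec hex
        have := hS.2.1 i _ j hs.1 h1 h3
        omega
      · refine ⟨S.sup (fun p => p.2) + 1, fun j h1 h2 => (hex ⟨j, h1, h2⟩).elim, ?_⟩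
        intro j h1 _ h3
        have := Finset.le_sup (f := fun p : ℕ × ℕ => p.2) h1
        simp only at this
        omega
    have h := hL i J v
    have e1 : c (v + 2) + n (v + 2) ≤ prefixCount lam mu T i J (v + 2) := by
      simp only [c, n]
      rw [← Finset.card_union_of_disjoint]
      · apply Finset.card_le_card
        rintro ⟨a, b⟩ hp
        simp only [Finset.mem_filter, Finset.mem_union] at hp ⊢
        rcases hp with ⟨h1, h2, h3⟩ | ⟨h1, h2, h3⟩
        · exact ⟨h1, Or.inl h2, h3⟩
        · subst h2
          exact ⟨h1, Or.inr ⟨rfl, hJ1 _ h1 h3⟩, h3⟩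
      · rw [Finset.disjoint_left]
        intro p h1 h2
        rw [Finset.mem_filter] at h1 h2
        omega
    have e2 : prefixCount lam mu T i J (v + 1) ≤ c (v + 1) := by
      apply Finset.card_le_card
      rintro ⟨a, b⟩ hp
      simp only [Finset.mem_filter] at hp ⊢
      obtain ⟨h1, h2 | ⟨h2, h2'⟩, h3⟩ := hp
      · exact ⟨h1, h2, h3⟩
      · subst h2
        exact (hJ2 _ h1 h3 h2').elim
    omega
  have hB : ∀ p ∈ S, T p < S.sup T + 1 := fun p hp =>
    Nat.lt_succ_of_le (Finset.le_sup (f := T) hp)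
  have hmain : ∀ t v, S.sup T ≤ v + t → g (v + 2) ≤ c (v + 1) := by
    intro t
    induction t with
    | zero =>
      intro v hv
      have : g (v + 2) = 0 := by
        simp only [g, Finset.card_eq_zero, Finset.filter_eq_empty_iff]
        intro p hp h
        have := hB p hp
        omega
      omega
    | succ t ih =>
      intro v hv
      have h1 := ih (v + 1) (by omega)
      have h2 := hstep v
      have h3 := hg (v + 2)
      have e : v + 1 + 2 = v + 2 + 1 := by omega
      have e' : v + 1 + 1 = v + 2 := by omega
      rw [e, e'] at h1
      omega
  have h1 := hmain (S.sup T) k (by omega)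
  have h2 : g (k + 1) = n (k + 1) + g (k + 2) := hg (k + 1)
  have h3 : c (k + 1) + n (k + 1) ≤ content lam mu T (k + 1) := by
    simp only [c, n]
    rw [← Finset.card_union_of_disjoint]
    · apply Finset.card_le_card
      intro p hp
      simp only [Finset.mem_filter, Finset.mem_union] at hp ⊢
      rcases hp with ⟨h1, h2, h3⟩ | ⟨h1, h2, h3⟩ <;> exact ⟨h1, h3⟩
    · rw [Finset.disjoint_left]
      intro p h1 h2
      rw [Finset.mem_filter] at h1 h2
      omega
  change g (k + 1) ≤ _
  omega

section GeoLemmas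

variable {lam mu : YoungDiagram} {l1 l2 l3 m L1 L2 L3 x : ℕ}

/-- Depth of a cell within its column. -/
def depth (m x : ℕ) (p : ℕ × ℕ) : ℕ := if p.2 < x then p.1 - m else p.1

theorem depth_lt (hG : Geo lam mu l1 l2 l3 m L1 L2 L3 x) {T : ℕ × ℕ → ℕ}
    (hS : IsSSYT lam mu T) : ∀ i j, (i, j) ∈ skewCells lam mu → depth m x (i, j) < T (i, j) := by
  intro i
  induction i with
  | zero =>
    intro j hj
    have := (hS.1 _).1 hj
    simp only [depth]
    split_ifs <;> omega
  | succ i ih =>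
    intro j hj
    have h0 := (hS.1 _).1 hj
    by_cases hc : (i, j) ∈ skewCells lam mu
    · have h1 := ih j hc
      have h2 := hS.2.2 i (i + 1) j hc hj (by omega)
      simp only [depth] at h1 ⊢
      split_ifs at h1 ⊢ <;> omega
    · rw [hG.mem] at hj hc
      simp only [depth]
      split_ifs <;> omega

theorem bound_lower (hG : Geo lam mu l1 l2 l3 m L1 L2 L3 x) {T : ℕ × ℕ → ℕ}
    (hS : IsSSYT lam mu T) (hL : IsLattice lam mu T) : L2 ≤ content lam mu T l1 := by
  have hG' := hG
  obtain ⟨hl1, hl2, hl3, hm, hx, h12, h23, h3, hml, hsub, hle, mem⟩ := hG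
  have h := row_lemma hS hL (m + l1 - 1) (l1 - 1)
  rw [show l1 - 1 + 1 = l1 by omega] at h
  refine le_trans ?_ h
  have : L2 = ((Finset.range L2).image fun j => (m + l1 - 1, j)).card := by
    rw [Finset.card_image_of_injective]
    · simp
    · intro a b h
      simpa using h
  rw [this]
  apply Finset.card_le_card
  intro p hp
  rw [Finset.mem_image] at hp
  obtain ⟨j, hj, rfl⟩ := hp
  rw [Finset.mem_range] at hj
  have hc : (m + l1 - 1, j) ∈ skewCells lam mu := by
    rw [mem]; omega
  refine Finset.mem_filter.2 ⟨hc, rfl, ?_⟩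
  have := depth_lt hG' hS _ _ hc
  simp only [depth] at this
  split_ifs at this <;> omega

theorem col_inj {T : ℕ × ℕ → ℕ} (hS : IsSSYT lam mu T) (k : ℕ) :
    Set.InjOn Prod.snd ((((skewCells lam mu).filter fun p => T p = k) : Finset (ℕ × ℕ)) : Set (ℕ × ℕ)) := by
  rintro ⟨i, j⟩ h ⟨i', j'⟩ h' heq
  simp only [Finset.coe_filter, Set.mem_ofPred_eq] at h h'
  simp only at heq
  subst heq
  rcases lt_trichotomy i i' with hlt | rfl | hlt
  · have := hS.2.2 _ _ _ h.1 h'.1 hlt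
    omega
  · rfl
  · have := hS.2.2 _ _ _ h'.1 h.1 hlt
    omega

theorem bound_upper (hG : Geo lam mu l1 l2 l3 m L1 L2 L3 x) {T : ℕ × ℕ → ℕ}
    (hS : IsSSYT lam mu T) (hL : IsLattice lam mu T) : content lam mu T (l1 + 1) ≤ L2 := by
  have h : content lam mu T (l1 + 1) ≤ (Finset.range L2).card := by
    apply Finset.card_le_card_of_injOn Prod.snd _ (col_inj hS (l1 + 1))
    rintro ⟨i, j⟩ hp
    simp only [Finset.coe_filter, Set.mem_ofPred_eq] at hp
    have h1 := entry_le hS hL i j hp.1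
    have h2 := (hG.mem i j).1 hp.1
    have h3 := hG.h23
    simp only [Finset.coe_range, Set.mem_Iio]
    omega
  simpa using h

/-- The explicit filling. -/
def fil (lam mu : YoungDiagram) (l1 m x X p : ℕ) (q : ℕ × ℕ) : ℕ :=
  if q ∈ skewCells lam mu then
    if x ≤ q.2 then q.1 + 1
    else if (X ≤ q.2 + p ∧ q.2 < X) ∧ l1 ≤ q.1 - m + min l1 m then q.1 - m + min l1 m + 1
    else q.1 - m + 1
  else 0

theorem fil_cell {X p i j : ℕ} (h : (i, j) ∈ skewCells lam mu) :
    fil lam mu l1 m x X p (i, j) =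
    if x ≤ j then i + 1
    else if (X ≤ j + p ∧ j < X) ∧ l1 ≤ i - m + min l1 m then i - m + min l1 m + 1
    else i - m + 1 := by
  simp [fil, h]

theorem fil_ssyt (hG : Geo lam mu l1 l2 l3 m L1 L2 L3 x) (p : ℕ) :
    IsSSYT lam mu (fil lam mu l1 m x (min L2 x) p) := by
  obtain ⟨hl1, hl2, hl3, hm, hx, h12, h23, h3, hml, hsub, hle, mem⟩ := hG
  refine ⟨?_, ?_, ?_⟩
  · intro q
    unfold fil
    constructor
    · intro h
      rw [if_pos h]
      split_ifs <;> omega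
    · intro h
      by_contra hc
      rw [if_neg hc] at h
      exact h rfl
  · intro i j1 j2 h1 h2 hj
    rw [fil_cell h1, fil_cell h2]
    rw [mem] at h1 h2
    split_ifs <;> omega
  · intro i1 i2 j h1 h2 hi
    rw [fil_cell h1, fil_cell h2]
    rw [mem] at h1 h2
    split_ifs <;> omega

theorem fil_lattice (hG : Geo lam mu l1 l2 l3 m L1 L2 L3 x) (p : ℕ)
    (hpY : p ≤ L1 - max L2 x) :
    IsLattice lam mu (fil lam mu l1 m x (min L2 x) p) := by
  obtain ⟨hl1, hl2, hl3, hm, hx, h12, h23, h3, hml, hsub, hle, mem⟩ := hG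
  intro i0 j0 k
  unfold prefixCount
  let φ : ℕ × ℕ → ℕ × ℕ := fun q =>
    if k + 1 = l1 ∧ min L2 x ≤ q.2 + p ∧ q.2 < min L2 x then
      (l1 - 1, q.2 + p - min L2 x + max L2 x) else (q.1 - 1, q.2)
  apply Finset.card_le_card_of_injOn φ
  · rintro ⟨i, j⟩ hq
    simp only [Finset.coe_filter, Set.mem_ofPred_eq] at hq ⊢
    obtain ⟨hc, hpos, hT⟩ := hq
    rw [fil_cell hc] at hT
    have hm' := (mem i j).1 hc
    by_cases hs : k + 1 = l1 ∧ min L2 x ≤ j + p ∧ j < min L2 x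
    · have e : φ (i, j) = (l1 - 1, j + p - min L2 x + max L2 x) := by
        simp only [φ]; rw [if_pos hs]
      have hc' : (l1 - 1, j + p - min L2 x + max L2 x) ∈ skewCells lam mu := by
        rw [mem]; omega
      rw [e, fil_cell hc']
      refine ⟨hc', ?_, ?_⟩
      · left
        simp only
        split_ifs at hT <;> omega
      · rw [if_pos (by omega)]; omega
    · have e : φ (i, j) = (i - 1, j) := by
        simp only [φ]; rw [if_neg hs]
      have hc' : (i - 1, j) ∈ skewCells lam mu := by
        rw [mem]; split_ifs at hT <;> omega
      rw [e, fil_cell hc']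
      refine ⟨hc', ?_, ?_⟩
      · left
        simp only
        split_ifs at hT <;> omega
      · split_ifs at hT ⊢ <;> omega
  · rintro ⟨i, j⟩ hq ⟨i', j'⟩ hq' heq
    simp only [Finset.coe_filter, Set.mem_ofPred_eq] at hq hq'
    obtain ⟨hc, -, hT⟩ := hq
    obtain ⟨hc', -, hT'⟩ := hq'
    rw [fil_cell hc] at hT
    rw [fil_cell hc'] at hT'
    rw [mem] at hc hc'
    simp only [φ] at heq
    rw [Prod.mk.injEq]
    split_ifs at heq with c1 c2 c2 <;> rw [Prod.mk.injEq] at heq <;>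
      (split_ifs at hT hT' <;> omega)

theorem sum_content {T : ℕ × ℕ → ℕ} (hS : IsSSYT lam mu T) (k : ℕ) :
    ∑ v ∈ Finset.range k, content lam mu T (v + 1) =
      ((skewCells lam mu).filter fun q => T q ≤ k).card := by
  induction k with
  | zero =>
    rw [Finset.range_zero, Finset.sum_empty, eq_comm, Finset.card_eq_zero,
      Finset.filter_eq_empty_iff]
    intro q hq h
    have := (hS.1 q).1 hq
    omega
  | succ k ih =>
    rw [Finset.sum_range_succ, ih, content, ← Finset.card_union_of_disjoint]
    · congr 1
      ext q
      simp only [Finset.mem_filter, Finset.mem_union, ← and_or_left]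
      refine and_congr_right fun _ => ?_
      omega
    · rw [Finset.disjoint_left]
      intro q h1 h2
      rw [Finset.mem_filter] at h1 h2
      omega

theorem dom (hG : Geo lam mu l1 l2 l3 m L1 L2 L3 x) {T : ℕ × ℕ → ℕ} (hS : IsSSYT lam mu T)
    (k : ℕ) : ∑ v ∈ Finset.range k, content lam mu T (v + 1) ≤
      ∑ v ∈ Finset.range k, content lam mu (fil lam mu l1 m x (min L2 x) 0) (v + 1) := by
  rw [sum_content hS, sum_content (fil_ssyt hG 0)]
  apply Finset.card_le_card
  rintro ⟨i, j⟩ hq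
  rw [Finset.mem_filter] at hq ⊢
  obtain ⟨hc, hk⟩ := hq
  refine ⟨hc, ?_⟩
  have h := depth_lt hG hS i j hc
  rw [fil_cell hc]
  simp only [depth] at h
  split_ifs at h ⊢ <;> omega

theorem fil_upper (hG : Geo lam mu l1 l2 l3 m L1 L2 L3 x) (p : ℕ) :
    content lam mu (fil lam mu l1 m x (min L2 x) p) l1 ≤ (min L2 x - p) + (L1 - x) := by
  have hS := fil_ssyt hG p
  obtain ⟨hl1, hl2, hl3, hm, hx, h12, h23, h3, hml, hsub, hle, mem⟩ := hG
  have h : content lam mu (fil lam mu l1 m x (min L2 x) p) l1 ≤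
      (Finset.range (min L2 x - p) ∪ Finset.Ico x L1).card := by
    apply Finset.card_le_card_of_injOn Prod.snd _ (col_inj hS l1)
    rintro ⟨i, j⟩ hq
    simp only [Finset.coe_filter, Set.mem_ofPred_eq] at hq
    obtain ⟨hc, hT⟩ := hq
    rw [fil_cell hc] at hT
    rw [mem] at hc
    simp only [Finset.mem_coe, Finset.mem_union, Finset.mem_range, Finset.mem_Ico]
    split_ifs at hT <;> omega
  refine h.trans ((Finset.card_union_le _ _).trans ?_)
  simp

theorem fil_lower_zero (hG : Geo lam mu l1 l2 l3 m L1 L2 L3 x) :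
    min L2 x + (L1 - x) ≤ content lam mu (fil lam mu l1 m x (min L2 x) 0) l1 := by
  obtain ⟨hl1, hl2, hl3, hm, hx, h12, h23, h3, hml, hsub, hle, mem⟩ := hG
  have hcard : min L2 x + (L1 - x) = (Finset.range (min L2 x) ∪ Finset.Ico x L1).card := by
    rw [Finset.card_union_of_disjoint]
    · simp
    · rw [Finset.disjoint_left]
      intro j h1 h2
      rw [Finset.mem_range] at h1
      rw [Finset.mem_Ico] at h2
      omega
  rw [hcard]
  apply Finset.card_le_card_of_injOn
    (fun j => if x ≤ j then (l1 - 1, j) else (m + l1 - 1, j))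
  · intro j hj
    simp only [Finset.mem_coe, Finset.mem_union, Finset.mem_range, Finset.mem_Ico] at hj
    simp only [Finset.coe_filter, Set.mem_ofPred_eq]
    by_cases hxj : x ≤ j
    · rw [if_pos hxj]
      have hc : (l1 - 1, j) ∈ skewCells lam mu := by rw [mem]; omega
      refine ⟨hc, ?_⟩
      rw [fil_cell hc]
      split_ifs; omega
    · rw [if_neg hxj]
      have hc : (m + l1 - 1, j) ∈ skewCells lam mu := by rw [mem]; omega
      refine ⟨hc, ?_⟩
      rw [fil_cell hc]
      split_ifs <;> omega
  · intro j _ j' _ heq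
    simp only at heq
    split_ifs at heq <;> rw [Prod.mk.injEq] at heq <;> omega

theorem fil_lower (hG : Geo lam mu l1 l2 l3 m L1 L2 L3 x) (p : ℕ) (hp : p ≤ min L2 x) :
    (L2 - min L2 x) + p + (if p < min L2 x then 1 else 0) ≤
      content lam mu (fil lam mu l1 m x (min L2 x) p) (l1 + 1) := by
  obtain ⟨hl1, hl2, hl3, hm, hx, h12, h23, h3, hml, hsub, hle, mem⟩ := hG
  have hcard : (L2 - min L2 x) + p + (if p < min L2 x then 1 else 0) =
      (Finset.range (if p < min L2 x then 1 else 0) ∪ Finset.Ico (min L2 x - p) L2).card := by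
    rw [Finset.card_union_of_disjoint]
    · simp only [Finset.card_range, Nat.card_Ico]
      omega
    · rw [Finset.disjoint_left]
      intro j h1 h2
      rw [Finset.mem_range] at h1
      rw [Finset.mem_Ico] at h2
      split_ifs at h1 <;> omega
  rw [hcard]
  apply Finset.card_le_card_of_injOn
    (fun j => if x ≤ j then (l1, j) else if min L2 x ≤ j + p then (m + l1 - min l1 m, j)
      else (m + l1, j))
  · intro j hj
    simp only [Finset.mem_coe, Finset.mem_union, Finset.mem_range, Finset.mem_Ico] at hj
    simp only [Finset.coe_filter, Set.mem_ofPred_eq]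
    by_cases hxj : x ≤ j
    · rw [if_pos hxj]
      have hc : (l1, j) ∈ skewCells lam mu := by
        rw [mem]; split_ifs at hj <;> omega
      refine ⟨hc, ?_⟩
      rw [fil_cell hc, if_pos hxj]
    · rw [if_neg hxj]
      by_cases hpj : min L2 x ≤ j + p
      · rw [if_pos hpj]
        have hc : (m + l1 - min l1 m, j) ∈ skewCells lam mu := by
          rw [mem]; split_ifs at hj <;> omega
        refine ⟨hc, ?_⟩
        rw [fil_cell hc]
        split_ifs at hj ⊢ <;> omega
      · rw [if_neg hpj]
        have hj0 : j = 0 := by split_ifs at hj <;> omega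
        have hc : (m + l1, j) ∈ skewCells lam mu := by
          rw [mem]; omega
        refine ⟨hc, ?_⟩
        rw [fil_cell hc]
        split_ifs <;> omega
  · intro j _ j' _ heq
    simp only at heq
    split_ifs at heq <;> rw [Prod.mk.injEq] at heq <;> omega

end GeoLemmas

/-- Transfer of a filling between two shapes with equal LR coefficients. -/
theorem transfer {lam mu alp bet : YoungDiagram} (h1 : mu ≤ lam) (h2 : bet ≤ alp)
    (heq : ∀ nu, lrCoeff lam mu nu = lrCoeff alp bet nu) {T : ℕ × ℕ → ℕ}
    (hS : IsSSYT lam mu T) (hL : IsLattice lam mu T) :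
    ∃ T', IsSSYT alp bet T' ∧ IsLattice alp bet T' ∧
      ∀ v, content alp bet T' (v + 1) = content lam mu T (v + 1) := by
  obtain ⟨nu, hnu⟩ := exists_nu hS hL
  have h := (lr_ne_zero_iff nu h1).2 ⟨T, hnu⟩
  rw [heq, lr_ne_zero_iff nu h2] at h
  obtain ⟨T', hS', hL', hc'⟩ := h
  exact ⟨T', hS', hL', fun v => by rw [hc', hnu.2.2]⟩

theorem half_dom {lam mu alp bet : YoungDiagram} {l1 l2 l3 m L1 L2 L3 x a2 a3 b A1 A2 A3 y : ℕ}
    (hG : Geo lam mu l1 l2 l3 m L1 L2 L3 x) (hH : Geo alp bet l1 a2 a3 b A1 A2 A3 y)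
    (heq : ∀ nu, lrCoeff lam mu nu = lrCoeff alp bet nu) (k : ℕ) :
    ∑ v ∈ Finset.range k, content lam mu (fil lam mu l1 m x (min L2 x) 0) (v + 1) ≤
      ∑ v ∈ Finset.range k, content alp bet (fil alp bet l1 b y (min A2 y) 0) (v + 1) := by
  obtain ⟨T', hS', hL', hc'⟩ := transfer hG.hle hH.hle heq (fil_ssyt hG 0)
    (fil_lattice hG 0 (Nat.zero_le _))
  have := dom hH hS' k
  simpa only [hc'] using this

theorem width_eq {lam mu alp bet : YoungDiagram} {l1 l2 l3 m L1 L2 L3 x a2 a3 b A1 A2 A3 y : ℕ}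
    (hG : Geo lam mu l1 l2 l3 m L1 L2 L3 x) (hH : Geo alp bet l1 a2 a3 b A1 A2 A3 y)
    (heq : ∀ nu, lrCoeff lam mu nu = lrCoeff alp bet nu) :
    min L2 x + (L1 - x) = min A2 y + (A1 - y) := by
  have h : ∀ k, ∑ v ∈ Finset.range k, content lam mu (fil lam mu l1 m x (min L2 x) 0) (v + 1) =
      ∑ v ∈ Finset.range k, content alp bet (fil alp bet l1 b y (min A2 y) 0) (v + 1) :=
    fun k => le_antisymm (half_dom hG hH heq k) (half_dom hH hG (fun nu => (heq nu).symm) k)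
  have e1 := h (l1 - 1)
  have e2 := h (l1 - 1 + 1)
  rw [Finset.sum_range_succ, Finset.sum_range_succ, e1, Nat.sub_add_cancel hG.hl1] at e2
  have u1 := fil_upper hG 0
  have u2 := fil_lower_zero hG
  have u3 := fil_upper hH 0
  have u4 := fil_lower_zero hH
  omega

theorem no_eq {lam mu alp bet : YoungDiagram} {l1 l2 l3 m L1 L2 L3 x a2 a3 b A1 A2 A3 y : ℕ}
    (hG : Geo lam mu l1 l2 l3 m L1 L2 L3 x) (hH : Geo alp bet l1 a2 a3 b A1 A2 A3 y)
    (hkey : (A2 : ℤ) - y = (L2 : ℤ) - x) (hlt : y < x)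
    (heq : ∀ nu, lrCoeff lam mu nu = lrCoeff alp bet nu) : False := by
  have hw := width_eq hG hH heq
  have g1 := hG.hsub
  have g2 := hH.hsub
  have g3 := hG.h12
  have g4 := hH.h12
  by_cases hcase : min A2 y ≤ L1 - max L2 x
  · obtain ⟨p, hp⟩ : ∃ p, p = min (min L2 x) (L1 - max L2 x) := ⟨_, rfl⟩
    obtain ⟨T', hS', hL', hc'⟩ := transfer hG.hle hH.hle heq (fil_ssyt hG p)
      (fil_lattice hG p (by omega))
    have h1 := bound_upper hH hS' hL'
    have h2 := fil_lower hG p (by omega)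
    rw [hc'] at h1
    split_ifs at h2 <;> omega
  · obtain ⟨p, hp⟩ : ∃ p, p = min (min A2 y) (A1 - max A2 y) := ⟨_, rfl⟩
    obtain ⟨T', hS', hL', hc'⟩ := transfer hH.hle hG.hle (fun nu => (heq nu).symm) (fil_ssyt hH p)
      (fil_lattice hH p (by omega))
    have h1 := bound_lower hG hS' hL'
    have h2 := fil_upper hH p
    have h3 := hc' (l1 - 1)
    rw [Nat.sub_add_cancel hG.hl1] at h3
    omega

/-- the construction of Case 1.3.1: under the stated numerical conditions with
`mu_1 ≠ bet_1`, the skew Schur functions of `lam/mu` and `alp/bet` differ. -/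
theorem construction_ne (lam mu alp bet : YoungDiagram)
    (lam1 lam2 lam3 alp1 alp2 alp3 : ℕ) (l1 l2 l3 a1 a2 a3 m b mu1 bet1 : ℕ)
    (hl1 : 0 < l1) (hl2 : 0 < l2) (hl3 : 0 < l3)
    (ha1 : 0 < a1) (ha2 : 0 < a2) (ha3 : 0 < a3)
    (hm : 0 < m) (hb : 0 < b) (hmu1 : 0 < mu1) (hbet1 : 0 < bet1)
    (hlam12 : lam2 < lam1) (hlam23 : lam3 < lam2) (hlam3 : 0 < lam3)
    (halp12 : alp2 < alp1) (halp23 : alp3 < alp2) (halp3 : 0 < alp3)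
    (hlam : ∀ i, lam.rowLen i =
      if i < l1 then lam1 else if i < l1 + l2 then lam2
        else if i < l1 + l2 + l3 then lam3 else 0)
    (halp : ∀ i, alp.rowLen i =
      if i < a1 then alp1 else if i < a1 + a2 then alp2
        else if i < a1 + a2 + a3 then alp3 else 0)
    (hmuShape : ∀ i, mu.rowLen i = if i < m then mu1 else 0)
    (hbetShape : ∀ i, bet.rowLen i = if i < b then bet1 else 0)
    (hmulam : mu ≤ lam) (hbetalp : bet ≤ alp)
    (hkey : (alp2 : ℤ) - bet1 = (lam2 : ℤ) - mu1)
    (ha1l1 : a1 = l1) (hml2 : m ≤ l2) (hba2 : b ≤ a2)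
    (hne : mu1 ≠ bet1) :
    ∃ nu : YoungDiagram, lrCoeff lam mu nu ≠ lrCoeff alp bet nu := by
  subst ha1l1
  have hG := geo_of lam mu a1 l2 l3 m lam1 lam2 lam3 mu1 hl1 hl2 hl3 hm hmu1 hlam12 hlam23 hlam3
    hlam hmuShape hmulam hml2
  have hH := geo_of alp bet a1 a2 a3 b alp1 alp2 alp3 bet1 ha1 ha2 ha3 hb hbet1 halp12 halp23
    halp3 halp hbetShape hbetalp hba2
  by_contra! heq
  rcases lt_or_gt_of_ne hne with h | h
  · exact no_eq hH hG hkey.symm h (fun nu => (heq nu).symm)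
  · exact no_eq hG hH hkey h heq

end LRSkew
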